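/- arXiv:2605.11586 — 2 statements merged into one kernel-verified Lean document; each statement's English description precedes it below -/
import Mathlib

section
/- Cesàro convergence of state distributions to the stationary distribution for a unichain stochastic matrix: Let M be a stochastic matrix on a finite nonempty type S. Suppose C ⊆ S is nonempty, closed under M, and irreducible under M, that every state s ∉ C is transient under M, and let d be a stationary distribution for M. Let μ₁ : S → ℝ satisfy μ₁(s) ≥ 0 for all s and ∑_s μ₁(s) = 1, and for t ≥ 1 define μ_t(s) = ∑_{s'} μ₁(s') · (M^{t-1})(s', s). Then for every s ∈ S, the Cesàro averages (1/n) ∑_{t=1}^{n} μ_t(s) converge to d(s) as n → ∞. -/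
open Finset Filter Topology

noncomputable section

/-- `M` is a stochastic matrix: nonnegative entries with unit row sums. -/
def IsStochastic {S : Type*} [Fintype S] (M : Matrix S S ℝ) : Prop :=
  (∀ s s', 0 ≤ M s s') ∧ ∀ s, ∑ s', M s s' = 1

/-- `C` is closed under the Markov matrix `M`. -/
def IsClosedClass {S : Type*} (M : Matrix S S ℝ) (C : Set S) : Prop :=
  ∀ s ∈ C, ∀ s' ∉ C, M s s' = 0

/-- `C` is irreducible under the Markov matrix `M`. -/
def IsIrreducibleOn {S : Type*} [Fintype S] [DecidableEq S] (M : Matrix S S ℝ)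
    (C : Set S) : Prop :=
  ∀ s ∈ C, ∀ s' ∈ C, ∃ n : ℕ, 0 < (M ^ n) s s'

/-- `s` is a transient state under the Markov matrix `M`. -/
def IsTransient {S : Type*} [Fintype S] [DecidableEq S] (M : Matrix S S ℝ) (s : S) : Prop :=
  Summable fun n : ℕ => (M ^ (n + 1)) s s

/-- `d` is a stationary distribution for `M`. -/
def IsStationaryDist {S : Type*} [Fintype S] (M : Matrix S S ℝ) (d : S → ℝ) : Prop :=
  (∀ s, 0 ≤ d s) ∧ (∑ s, d s = 1) ∧ ∀ s, ∑ s', M s' s * d s' = d s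

theorem IsStochastic.pow_nonneg {S : Type*} [Fintype S] [DecidableEq S] {M : Matrix S S ℝ}
    (hM : IsStochastic M) (n : ℕ) (s s' : S) : 0 ≤ (M ^ n) s s' := by
  induction n generalizing s' with
  | zero => by_cases h : s = s' <;> simp [h]
  | succ n ih =>
    rw [pow_succ, Matrix.mul_apply]
    exact Finset.sum_nonneg fun u _ => mul_nonneg (ih u) (hM.1 u s')

theorem IsStochastic.sum_vecMul {S : Type*} [Fintype S] {M : Matrix S S ℝ}
    (hM : IsStochastic M) (x : S → ℝ) : ∑ s, Matrix.vecMul x M s = ∑ s, x s := by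
  simp only [Matrix.vecMul, dotProduct]
  rw [Finset.sum_comm]
  simp [← Finset.mul_sum, hM.2]

theorem IsStochastic.sum_vecMul_pow {S : Type*} [Fintype S] [DecidableEq S] {M : Matrix S S ℝ}
    (hM : IsStochastic M) (x : S → ℝ) (n : ℕ) :
    ∑ s, Matrix.vecMul x (M ^ n) s = ∑ s, x s := by
  induction n with
  | zero => simp
  | succ n ih => rw [pow_succ, ← Matrix.vecMul_vecMul, hM.sum_vecMul, ih]

theorem IsStochastic.vecMul_pow_mem_stdSimplex {S : Type*} [Fintype S] [DecidableEq S]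
    {M : Matrix S S ℝ} (hM : IsStochastic M) {x : S → ℝ} (hx : x ∈ stdSimplex ℝ S) (n : ℕ) :
    Matrix.vecMul x (M ^ n) ∈ stdSimplex ℝ S :=
  ⟨fun s => Finset.sum_nonneg fun u _ => mul_nonneg (hx.1 u) (hM.pow_nonneg n u s),
    (hM.sum_vecMul_pow x n).trans hx.2⟩

theorem vecMul_pow_of_vecMul_eq {S : Type*} [Fintype S] [DecidableEq S] {M : Matrix S S ℝ}
    {x : S → ℝ} (hx : Matrix.vecMul x M = x) (n : ℕ) : Matrix.vecMul x (M ^ n) = x := by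
  induction n with
  | zero => simp
  | succ n ih => rw [pow_succ, ← Matrix.vecMul_vecMul, ih, hx]

/-- The expected number of visits to `s` before time `N` is largest when starting from `s`. -/
theorem IsStochastic.sum_range_pow_le {S : Type*} [Fintype S] [DecidableEq S] {M : Matrix S S ℝ}
    (hM : IsStochastic M) (s : S) (N : ℕ) (s' : S) :
    ∑ n ∈ Finset.range N, (M ^ n) s' s ≤ ∑ n ∈ Finset.range N, (M ^ n) s s := by
  induction N generalizing s' with
  | zero => simp
  | succ N ih =>
    rcases eq_or_ne s' s with rfl | hne
    · exact le_rfl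
    calc ∑ n ∈ Finset.range (N + 1), (M ^ n) s' s
        = ∑ u, M s' u * ∑ n ∈ Finset.range N, (M ^ n) u s := by
          rw [Finset.sum_range_succ']
          simp only [pow_succ', Matrix.mul_apply, pow_zero, Matrix.one_apply_ne hne, add_zero,
            Finset.mul_sum]
          exact Finset.sum_comm
      _ ≤ ∑ u, M s' u * ∑ n ∈ Finset.range N, (M ^ n) s s :=
          Finset.sum_le_sum fun u _ => mul_le_mul_of_nonneg_left (ih u) (hM.1 s' u)
      _ = ∑ n ∈ Finset.range N, (M ^ n) s s := by rw [← Finset.sum_mul, hM.2, one_mul]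
      _ ≤ ∑ n ∈ Finset.range (N + 1), (M ^ n) s s := by
          rw [Finset.sum_range_succ]
          exact le_add_of_nonneg_right (hM.pow_nonneg N s s)

theorem IsTransient.tendsto_pow_zero {S : Type*} [Fintype S] [DecidableEq S] {M : Matrix S S ℝ}
    (hM : IsStochastic M) {s : S} (hs : IsTransient M s) (s' : S) :
    Tendsto (fun n : ℕ => (M ^ n) s' s) atTop (𝓝 0) := by
  have hs' : Summable fun n : ℕ => (M ^ n) s s := (summable_nat_add_iff 1).1 hs
  exact (summable_of_sum_range_le (fun n => hM.pow_nonneg n s' s) fun N =>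
    (hM.sum_range_pow_le s N s').trans
      (hs'.sum_le_tsum _ fun n _ => hM.pow_nonneg n s s)).tendsto_atTop_zero

theorem IsTransient.eq_zero_of_vecMul_eq {S : Type*} [Fintype S] [DecidableEq S]
    {M : Matrix S S ℝ} (hM : IsStochastic M) {s : S} (hs : IsTransient M s) {x : S → ℝ}
    (hx : Matrix.vecMul x M = x) : x s = 0 := by
  have h : Tendsto (fun n : ℕ => ∑ u, x u * (M ^ n) u s) atTop (𝓝 (∑ u, x u * 0)) :=
    tendsto_finsetSum _ fun u _ => (hs.tendsto_pow_zero hM u).const_mul (x u)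
  have hconst (n : ℕ) : ∑ u, x u * (M ^ n) u s = x s :=
    congrFun (vecMul_pow_of_vecMul_eq hx n) s
  simpa [hconst] using h

theorem IsStochastic.vecMul_abs_eq {S : Type*} [Fintype S] {M : Matrix S S ℝ}
    (hM : IsStochastic M) {v : S → ℝ} (hv : Matrix.vecMul v M = v) :
    Matrix.vecMul (fun s => |v s|) M = fun s => |v s| := by
  have hle (s : S) : |v s| ≤ Matrix.vecMul (fun s => |v s|) M s := by
    calc |v s| = |∑ u, v u * M u s| := congrArg abs (congrFun hv s).symm
      _ ≤ ∑ u, |v u * M u s| := Finset.abs_sum_le_sum_abs _ _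
      _ = ∑ u, |v u| * M u s := by simp only [abs_mul, abs_of_nonneg (hM.1 _ s)]
  funext s
  exact ((Finset.sum_eq_sum_iff_of_le fun s _ => hle s).1
    (hM.sum_vecMul fun s => |v s|).symm s (Finset.mem_univ s)).symm

/-- A signed invariant vector of total mass zero vanishes if the chain has a single
irreducible class and all other states are transient. -/
theorem IsStochastic.eq_zero_of_vecMul_eq {S : Type*} [Fintype S] [DecidableEq S]
    {M : Matrix S S ℝ} (hM : IsStochastic M) {C : Set S} (hirr : IsIrreducibleOn M C)
    (htrans : ∀ s ∉ C, IsTransient M s) {v : S → ℝ} (hv : Matrix.vecMul v M = v)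
    (hsum : ∑ s, v s = 0) : v = 0 := by
  have hoff (s : S) (hs : s ∉ C) : v s = 0 := (htrans s hs).eq_zero_of_vecMul_eq hM hv
  have hpos : Matrix.vecMul ((fun s => |v s|) + v) M = (fun s => |v s|) + v := by
    rw [Matrix.add_vecMul, hM.vecMul_abs_eq hv, hv]
  have hnonneg (s : S) : 0 ≤ |v s| + v s := by linarith [neg_abs_le (v s)]
  have hnonpos (s : S) : v s ≤ 0 := by
    by_contra! hs
    have hsC : s ∈ C := by
      by_contra h
      exact hs.ne' (hoff s h)
    have hall (u : S) : 0 ≤ v u := by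
      by_cases hu : u ∈ C
      · obtain ⟨n, hn⟩ := hirr s hsC u hu
        have hflow : (|v s| + v s) * (M ^ n) s u ≤ |v u| + v u := by
          rw [← Pi.add_apply (fun s => |v s|) v u, ← congrFun (vecMul_pow_of_vecMul_eq hpos n) u]
          exact Finset.single_le_sum (f := fun w => (|v w| + v w) * (M ^ n) w u)
            (fun w _ => mul_nonneg (hnonneg w) (hM.pow_nonneg n w u)) (Finset.mem_univ s)
        have hlt : 0 < (|v s| + v s) * (M ^ n) s u := by positivity
        by_contra! hneg
        rw [abs_of_neg hneg] at hflow
        linarith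
      · exact (hoff u hu).ge
    exact hs.ne' ((Finset.sum_eq_zero_iff_of_nonneg fun u _ => hall u).1 hsum s (Finset.mem_univ s))
  funext s
  exact (Finset.sum_eq_zero_iff_of_nonpos fun u _ => hnonpos u).1 hsum s (Finset.mem_univ s)

/-- The average of the first `n` state distributions of the chain started from `x`. -/
def cesaroAverage {S : Type*} [Fintype S] [DecidableEq S] (M : Matrix S S ℝ) (x : S → ℝ)
    (n : ℕ) : S → ℝ :=
  (1 / (n : ℝ)) • ∑ t ∈ Finset.range n, Matrix.vecMul x (M ^ t)

theorem cesaroAverage_apply {S : Type*} [Fintype S] [DecidableEq S] (M : Matrix S S ℝ)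
    (x : S → ℝ) (n : ℕ) (s : S) :
    cesaroAverage M x n s = (1 / (n : ℝ)) * ∑ t ∈ Finset.range n, ∑ u, x u * (M ^ t) u s := by
  simp [cesaroAverage, Matrix.vecMul, dotProduct]

theorem IsStochastic.cesaroAverage_mem_stdSimplex {S : Type*} [Fintype S] [DecidableEq S]
    {M : Matrix S S ℝ} (hM : IsStochastic M) {x : S → ℝ} (hx : x ∈ stdSimplex ℝ S) {n : ℕ}
    (hn : n ≠ 0) : cesaroAverage M x n ∈ stdSimplex ℝ S := by
  rw [cesaroAverage, Finset.smul_sum]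
  refine (convex_stdSimplex ℝ S).sum_mem (fun _ _ => by positivity) ?_
    fun t _ => hM.vecMul_pow_mem_stdSimplex hx t
  simp [hn]

theorem cesaroAverage_vecMul_sub {S : Type*} [Fintype S] [DecidableEq S] (M : Matrix S S ℝ)
    (x : S → ℝ) (n : ℕ) :
    Matrix.vecMul (cesaroAverage M x n) M - cesaroAverage M x n =
      (1 / (n : ℝ)) • (Matrix.vecMul x (M ^ n) - x) := by
  rw [cesaroAverage, Matrix.smul_vecMul, ← smul_sub, Matrix.sum_vecMul,
    ← Finset.sum_sub_distrib]
  simp only [Matrix.vecMul_vecMul, ← pow_succ]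
  rw [Finset.sum_range_sub fun t => Matrix.vecMul x (M ^ t)]
  simp

theorem IsStochastic.tendsto_cesaroAverage_vecMul_sub {S : Type*} [Fintype S] [DecidableEq S]
    {M : Matrix S S ℝ} (hM : IsStochastic M) {x : S → ℝ} (hx : x ∈ stdSimplex ℝ S) :
    Tendsto (fun n => Matrix.vecMul (cesaroAverage M x n) M - cesaroAverage M x n)
      atTop (𝓝 0) := by
  simp only [cesaroAverage_vecMul_sub]
  obtain ⟨K, hK⟩ := (isCompact_stdSimplex ℝ S).isBounded.exists_norm_le
  refine tendsto_one_div_atTop_nhds_zero_nat.zero_smul_isBoundedUnder_le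
    (isBoundedUnder_of ⟨K + K, fun n => ?_⟩)
  exact (norm_sub_le _ _).trans
    (add_le_add (hK _ (hM.vecMul_pow_mem_stdSimplex hx n)) (hK _ hx))

/-- **Cesàro convergence of state distributions for a unichain stochastic matrix.**
With `μ_t(s) = ∑_{s'} μ₁(s') (M^{t-1})(s',s)`, the Cesàro averages `(1/n) ∑_{t=1}^n μ_t(s)`
converge to the stationary distribution `d(s)` for every state `s`. -/
theorem cesaro_convergence_to_stationary
    {S : Type*} [Fintype S] [DecidableEq S] [Nonempty S]
    (M : Matrix S S ℝ) (hM : IsStochastic M)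
    (C : Set S) (hC : C.Nonempty)
    (hclosed : IsClosedClass M C) (hirr : IsIrreducibleOn M C)
    (htrans : ∀ s ∉ C, IsTransient M s)
    (d : S → ℝ) (hd : IsStationaryDist M d)
    (μ₁ : S → ℝ) (hμ0 : ∀ s, 0 ≤ μ₁ s) (hμ1 : ∑ s, μ₁ s = 1) :
    ∀ s : S, Tendsto
      (fun n : ℕ => (1 / (n : ℝ)) * ∑ t ∈ Finset.range n, ∑ s', μ₁ s' * (M ^ t) s' s)
      atTop (𝓝 (d s)) := by
  have hμ : μ₁ ∈ stdSimplex ℝ S := ⟨hμ0, hμ1⟩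
  have hdM : Matrix.vecMul d M = d := by
    funext s
    simpa [Matrix.vecMul, dotProduct, mul_comm] using hd.2.2 s
  have hlim : Tendsto (cesaroAverage M μ₁) atTop (𝓝 d) := by
    refine (isCompact_stdSimplex ℝ S).tendsto_nhds_of_unique_mapClusterPt
      ((eventually_ne_atTop 0).mono fun n hn => hM.cesaroAverage_mem_stdSimplex hμ hn) ?_
    intro y hy hcluster
    obtain ⟨U, hU, hUy⟩ := mapClusterPt_iff_ultrafilter.1 hcluster
    have hcont : Continuous fun a : S → ℝ => Matrix.vecMul a M - a := by fun_prop
    have hyM : Matrix.vecMul y M - y = 0 :=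
      tendsto_nhds_unique ((hcont.tendsto y).comp hUy)
        ((hM.tendsto_cesaroAverage_vecMul_sub hμ).mono_left hU)
    refine sub_eq_zero.1 (hM.eq_zero_of_vecMul_eq hirr htrans (v := y - d) ?_ ?_)
    · rw [Matrix.sub_vecMul, hdM, sub_eq_zero.1 hyM]
    · simp [Finset.sum_sub_distrib, hy.2, hd.2.1]
  intro s
  simpa only [cesaroAverage_apply] using (tendsto_pi_nhds.1 hlim) s
end
end

section
/- Every relative-interior point of the flow polytope is the occupation measure of a unichain stationary policy: Let (S, A, P) be a weakly communicating MDP with finite state space S and finite action space A, let s₁ ∈ S be any initial state, and let q* belong to the relative interior of the flow polytope 𝓟. Then there exists π ∈ Π such that: (1) P_π is unichain, i.e., there is a nonempty set C ⊆ S that is closed and irreducible under P_π and every state s ∉ C is transient under P_π; and (2) for every (s, a) ∈ S × A, the Cesàro averages (1/T) ∑_{t=1}^{T} (P_π^{t-1})(s₁, s) · π s a converge to q*(s, a) as T → ∞, i.e., q* is the occupation measure of π from s₁. -/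
open Finset Filter Topology

noncomputable section

/-- `P` is a transition kernel: nonnegative and each row sums to one. -/
def IsKernel {S A : Type*} [Fintype S] (P : S → A → S → ℝ) : Prop :=
  (∀ s a s', 0 ≤ P s a s') ∧ ∀ s a, ∑ s', P s a s' = 1

/-- `π` is a stationary randomized policy. -/
def IsPolicy {S A : Type*} [Fintype A] (π : S → A → ℝ) : Prop :=
  (∀ s a, 0 ≤ π s a) ∧ ∀ s, ∑ a, π s a = 1

/-- The Markov matrix induced by policy `π` on kernel `P`. -/
def markovMatrix {S A : Type*} [Fintype A] (P : S → A → S → ℝ) (π : S → A → ℝ) :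
    Matrix S S ℝ :=
  fun s s' => ∑ a, π s a * P s a s'

/-- The MDP `(S, A, P)` is weakly communicating. -/
def WeaklyCommunicating {S A : Type*} [Fintype S] [DecidableEq S] [Fintype A]
    (P : S → A → S → ℝ) : Prop :=
  ∃ (π : S → A → ℝ) (C : Set S), IsPolicy π ∧ C.Nonempty ∧
    IsClosedClass (markovMatrix P π) C ∧ IsIrreducibleOn (markovMatrix P π) C ∧
    ∀ s ∉ C, ∀ π' : S → A → ℝ, IsPolicy π' → IsTransient (markovMatrix P π') s

/-- `q` is the occupation measure of the policy `π` from initial state `s₁`: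
the Cesàro averages `(1/T) ∑_{t=1}^T (P_π^{t-1})(s₁,s) ⬝ π s a` converge to `q (s,a)`. -/
def IsOccupation {S A : Type*} [Fintype S] [DecidableEq S] [Fintype A]
    (P : S → A → S → ℝ) (π : S → A → ℝ) (s₁ : S) (q : S × A → ℝ) : Prop :=
  ∀ s a, Tendsto
    (fun T : ℕ => (1 / (T : ℝ)) * ∑ t ∈ Finset.range T, ((markovMatrix P π) ^ t) s₁ s * π s a)
    atTop (𝓝 (q (s, a)))

/-- `Q(s₁)`: the set of occupation measures of stationary policies from `s₁`. -/
def occSet {S A : Type*} [Fintype S] [DecidableEq S] [Fintype A]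
    (P : S → A → S → ℝ) (s₁ : S) : Set (S × A → ℝ) :=
  {q | ∃ π : S → A → ℝ, IsPolicy π ∧ IsOccupation P π s₁ q}

/-- `c·q = ∑_{(s,a)} c(s,a) q(s,a)`. -/
def dotSA {S A : Type*} [Fintype S] [Fintype A] (c q : S × A → ℝ) : ℝ :=
  ∑ p, c p * q p

/-- The dual function `D(λ) = sup { r·q + λ(g·q − b) : q ∈ Q(s₁) }`. -/
def dualFn {S A : Type*} [Fintype S] [DecidableEq S] [Fintype A]
    (P : S → A → S → ℝ) (s₁ : S) (r g : S × A → ℝ) (b : ℝ) (lam : ℝ) : ℝ :=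
  sSup {x | ∃ q ∈ occSet P s₁, x = dotSA r q + lam * (dotSA g q - b)}

/-- The flow polytope `𝓟`. -/
def flowPolytope {S A : Type*} [Fintype S] [Fintype A] (P : S → A → S → ℝ) :
    Set (S × A → ℝ) :=
  {q | (∀ p, 0 ≤ q p) ∧ (∑ p, q p = 1) ∧
    ∀ s, ∑ a, q (s, a) = ∑ p : S × A, P p.1 p.2 s * q p}

section StochasticMatrix

open Matrix

variable {S : Type*} [Fintype S] [DecidableEq S]

/-- Time averages of the distributions of a Markov chain started at `s₁`. -/
def cesaroRow (M : Matrix S S ℝ) (s₁ : S) (T : ℕ) : S → ℝ :=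
  (T : ℝ)⁻¹ • ∑ t ∈ Finset.range T, (M ^ t).row s₁

lemma cesaroRow_mem_stdSimplex {M : Matrix S S ℝ} (hM : M ∈ rowStochastic ℝ S) (s₁ : S)
    {T : ℕ} (hT : 0 < T) : cesaroRow M s₁ T ∈ stdSimplex ℝ S := by
  have hpow (t : ℕ) : M ^ t ∈ rowStochastic ℝ S := pow_mem hM t
  refine ⟨fun s => ?_, ?_⟩
  · simp only [cesaroRow, Pi.smul_apply, Finset.sum_apply, smul_eq_mul]
    exact mul_nonneg (by positivity) (sum_nonneg fun t _ => (hpow t).1 _ _)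
  · simp only [cesaroRow, Pi.smul_apply, Finset.sum_apply, smul_eq_mul, ← mul_sum]
    rw [sum_comm]
    simp only [Matrix.row_apply, sum_row_of_mem_rowStochastic (hpow _)]
    have : (T : ℝ) ≠ 0 := by positivity
    simp [this]

lemma tendsto_cesaroRow_vecMul_sub {M : Matrix S S ℝ} (hM : M ∈ rowStochastic ℝ S) (s₁ : S) :
    Tendsto (fun T => cesaroRow M s₁ T ᵥ* M - cesaroRow M s₁ T) atTop (𝓝 0) := by
  have hstep (t : ℕ) : (M ^ t).row s₁ ᵥ* M = (M ^ (t + 1)).row s₁ := by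
    ext s
    simp [pow_succ, Matrix.mul_apply, Matrix.vecMul, dotProduct]
  have htele (T : ℕ) : cesaroRow M s₁ T ᵥ* M - cesaroRow M s₁ T =
      (T : ℝ)⁻¹ • ((M ^ T).row s₁ - (M ^ 0).row s₁) := by
    rw [cesaroRow, Matrix.smul_vecMul, Matrix.sum_vecMul, ← smul_sub, ← sum_sub_distrib]
    simp only [hstep]
    rw [Finset.sum_range_sub (fun t => (M ^ t).row s₁)]
  simp only [htele]
  rw [tendsto_pi_nhds]
  intro s
  have hentry (t : ℕ) : 0 ≤ (M ^ t) s₁ s ∧ (M ^ t) s₁ s ≤ 1 :=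
    ⟨(pow_mem hM t).1 _ _, le_one_of_mem_rowStochastic (pow_mem hM t)⟩
  refine squeeze_zero_norm (a := fun T : ℕ => (T : ℝ)⁻¹) (fun T => ?_)
    tendsto_inv_atTop_nhds_zero_nat
  simp only [Pi.smul_apply, Pi.sub_apply, Matrix.row_apply, smul_eq_mul, norm_mul, norm_inv,
    Real.norm_natCast]
  refine mul_le_of_le_one_right (by positivity) ?_
  rw [Real.norm_eq_abs, abs_le]
  constructor <;> linarith [(hentry T).1, (hentry T).2, (hentry 0).1, (hentry 0).2]

lemma vecMul_eq_of_mapClusterPt_cesaroRow {M : Matrix S S ℝ} (hM : M ∈ rowStochastic ℝ S)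
    {s₁ : S} {ν : S → ℝ} (hν : MapClusterPt ν atTop (cesaroRow M s₁)) : ν ᵥ* M = ν := by
  have hcont : Continuous fun x : S → ℝ => x ᵥ* M - x :=
    (Continuous.matrix_vecMul continuous_id continuous_const).sub continuous_id
  have hcl := hν.continuousAt_comp hcont.continuousAt
  have hle := inf_le_inf_left (𝓝 (ν ᵥ* M - ν)) (tendsto_cesaroRow_vecMul_sub hM s₁)
  have : (𝓝 (ν ᵥ* M - ν) ⊓ 𝓝 0).NeBot := NeBot.mono hcl hle
  exact sub_eq_zero.1 (eq_of_nhds_neBot this)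

lemma exists_stationary {M : Matrix S S ℝ} [Nonempty S] (hM : M ∈ rowStochastic ℝ S) :
    ∃ ν ∈ stdSimplex ℝ S, ν ᵥ* M = ν := by
  obtain ⟨s₁⟩ := ‹Nonempty S›
  have hev : ∀ᶠ T in atTop, cesaroRow M s₁ T ∈ stdSimplex ℝ S :=
    (eventually_gt_atTop 0).mono fun T hT => cesaroRow_mem_stdSimplex hM s₁ hT
  obtain ⟨ν, hν, hcl⟩ := (isCompact_stdSimplex ℝ S).exists_mapClusterPt (le_principal_iff.2 hev)
  exact ⟨ν, hν, vecMul_eq_of_mapClusterPt_cesaroRow hM hcl⟩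

lemma tendsto_cesaroRow_of_unique {M : Matrix S S ℝ} (hM : M ∈ rowStochastic ℝ S) (s₁ : S)
    {μ : S → ℝ} (huniq : ∀ ν ∈ stdSimplex ℝ S, ν ᵥ* M = ν → ν = μ) :
    Tendsto (cesaroRow M s₁) atTop (𝓝 μ) :=
  (isCompact_stdSimplex ℝ S).tendsto_nhds_of_unique_mapClusterPt
    ((eventually_gt_atTop 0).mono fun _ hT => cesaroRow_mem_stdSimplex hM s₁ hT)
    fun ν hν hcl => huniq ν hν (vecMul_eq_of_mapClusterPt_cesaroRow hM hcl)

lemma vecMul_pow_eq {M : Matrix S S ℝ} {ν : S → ℝ} (hν : ν ᵥ* M = ν) (n : ℕ) :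
    ν ᵥ* M ^ n = ν := by
  induction n with
  | zero => simp
  | succ n ih => rw [pow_succ, ← Matrix.vecMul_vecMul, ih, hν]

/-- The expected number of visits to a transient state is bounded uniformly in the initial
state. -/
lemma IsTransient.exists_sum_pow_le {M : Matrix S S ℝ} (hM : M ∈ rowStochastic ℝ S) {s : S}
    (hs : IsTransient M s) : ∃ B : ℝ, ∀ n u, ∑ t ∈ Finset.range n, (M ^ t) u s ≤ B := by
  have hsum : Summable fun n => (M ^ n) s s := (summable_nat_add_iff 1).1 hs
  refine ⟨∑' n, (M ^ n) s s, fun n => ?_⟩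
  have hself (n : ℕ) : ∑ t ∈ Finset.range n, (M ^ t) s s ≤ ∑' n, (M ^ n) s s :=
    hsum.sum_le_tsum _ fun t _ => (pow_mem hM t).1 _ _
  induction n with
  | zero => intro u; simpa using hself 0
  | succ n ih =>
    intro u
    rcases eq_or_ne u s with rfl | hus
    · exact hself (n + 1)
    · rw [Finset.sum_range_succ']
      simp only [pow_succ', Matrix.mul_apply, pow_zero, Matrix.one_apply_ne hus, add_zero]
      rw [sum_comm]
      simp only [← mul_sum]
      calc ∑ v, M u v * ∑ t ∈ Finset.range n, (M ^ t) v s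
          ≤ ∑ v, M u v * ∑' n, (M ^ n) s s :=
            sum_le_sum fun v _ => mul_le_mul_of_nonneg_left (ih v) (hM.1 u v)
        _ = ∑' n, (M ^ n) s s := by
            rw [← sum_mul, sum_row_of_mem_rowStochastic hM, one_mul]

lemma IsTransient.stationary_eq_zero {M : Matrix S S ℝ} (hM : M ∈ rowStochastic ℝ S) {s : S}
    (hs : IsTransient M s) {ν : S → ℝ} (hν : ν ∈ stdSimplex ℝ S) (hst : ν ᵥ* M = ν) :
    ν s = 0 := by
  obtain ⟨B, hB⟩ := hs.exists_sum_pow_le hM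
  have hle (n : ℕ) : n • ν s ≤ B := by
    calc n • ν s = ∑ t ∈ Finset.range n, (ν ᵥ* M ^ t) s := by simp [vecMul_pow_eq hst]
      _ = ∑ u, ν u * ∑ t ∈ Finset.range n, (M ^ t) u s := by
          simp only [Matrix.vecMul, dotProduct, mul_sum]
          exact sum_comm
      _ ≤ ∑ u, ν u * B := sum_le_sum fun u _ => mul_le_mul_of_nonneg_left (hB n u) (hν.1 u)
      _ = B := by rw [← sum_mul, hν.2, one_mul]
  by_contra hne
  obtain ⟨n, hn⟩ := exists_lt_nsmul (lt_of_le_of_ne (hν.1 s) (Ne.symm hne)) B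
  exact absurd (hle n) (not_le.2 hn)

lemma pos_of_stationary_of_pow_pos {M : Matrix S S ℝ} (hM : M ∈ rowStochastic ℝ S)
    {ν : S → ℝ} (hν : ∀ s, 0 ≤ ν s) (hst : ν ᵥ* M = ν) {s s' : S} {n : ℕ}
    (hs : 0 < ν s) (hn : 0 < (M ^ n) s s') : 0 < ν s' := by
  rw [← vecMul_pow_eq hst n]
  exact sum_pos' (fun u _ => mul_nonneg (hν u) ((pow_mem hM n).1 _ _))
    ⟨s, mem_univ s, mul_pos hs hn⟩

lemma stationary_pos_on {M : Matrix S S ℝ} (hM : M ∈ rowStochastic ℝ S) {C : Set S}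
    (hirr : IsIrreducibleOn M C) (htr : ∀ s ∉ C, IsTransient M s)
    {ν : S → ℝ} (hν : ν ∈ stdSimplex ℝ S) (hst : ν ᵥ* M = ν) {s : S} (hs : s ∈ C) :
    0 < ν s := by
  obtain ⟨u, -, hu⟩ : ∃ u ∈ univ, ν u ≠ 0 := by
    by_contra! h
    exact zero_ne_one ((sum_eq_zero h).symm.trans hν.2)
  have huC : u ∈ C := by
    by_contra h
    exact hu ((htr u h).stationary_eq_zero hM hν hst)
  obtain ⟨n, hn⟩ := hirr u huC s hs
  exact pos_of_stationary_of_pow_pos hM hν.1 hst (lt_of_le_of_ne (hν.1 u) hu.symm) hn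

/-- A unichain stochastic matrix has at most one stationary distribution. -/
lemma stationary_unique {M : Matrix S S ℝ} (hM : M ∈ rowStochastic ℝ S) {C : Set S}
    (hC : C.Nonempty) (hirr : IsIrreducibleOn M C) (htr : ∀ s ∉ C, IsTransient M s)
    {μ ν : S → ℝ} (hμ : μ ∈ stdSimplex ℝ S) (hμM : μ ᵥ* M = μ)
    (hν : ν ∈ stdSimplex ℝ S) (hνM : ν ᵥ* M = ν) : ν = μ := by
  have hμ_pos (s : S) (hs : s ∈ C) : 0 < μ s := stationary_pos_on hM hirr htr hμ hμM hs
  obtain ⟨s₀, hs₀, hmin⟩ := C.toFinite.exists_minimalFor (fun s => ν s / μ s) C hC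
  set c := ν s₀ / μ s₀ with hc
  have hcle (s : S) (hs : s ∈ C) : c * μ s ≤ ν s := by
    rw [← le_div_iff₀ (hμ_pos s hs)]
    exact (le_total c (ν s / μ s)).elim id fun h => hmin hs h
  have hzero (s : S) (hs : s ∉ C) : μ s = 0 ∧ ν s = 0 :=
    ⟨(htr s hs).stationary_eq_zero hM hμ hμM, (htr s hs).stationary_eq_zero hM hν hνM⟩
  have hd_nonneg (s : S) : 0 ≤ (ν - c • μ) s := by
    by_cases hs : s ∈ C
    · simpa using hcle s hs
    · simp [hzero s hs]
  have hdM : (ν - c • μ) ᵥ* M = ν - c • μ := by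
    rw [Matrix.sub_vecMul, Matrix.smul_vecMul, hμM, hνM]
  have hd₀ : (ν - c • μ) s₀ = 0 := by
    simp [hc, (hμ_pos s₀ hs₀).ne']
  have hd (s : S) : ν s = c * μ s := by
    by_cases hs : s ∈ C
    · by_contra hne
      have hpos : 0 < (ν - c • μ) s :=
        lt_of_le_of_ne (hd_nonneg s) (by simpa using fun h => hne (sub_eq_zero.1 h.symm))
      obtain ⟨n, hn⟩ := hirr s hs s₀ hs₀
      exact (pos_of_stationary_of_pow_pos hM hd_nonneg hdM hpos hn).ne' hd₀
    · simp [hzero s hs]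
  have hc1 : c = 1 := by
    have := hν.2
    simp only [hd, ← mul_sum, hμ.2, mul_one] at this
    exact this
  ext s
  rw [hd, hc1, one_mul]

/-- Irreducibility of a closed class passes to a matrix with more positive entries. -/
lemma IsIrreducibleOn.of_pos_imp {M N : Matrix S S ℝ} {C : Set S}
    (hM : M ∈ rowStochastic ℝ S) (hN : N ∈ rowStochastic ℝ S) (hcl : IsClosedClass M C)
    (hirr : IsIrreducibleOn M C) (hMN : ∀ s ∈ C, ∀ s', 0 < M s s' → 0 < N s s') :
    IsIrreducibleOn N C := by
  have key (n : ℕ) : ∀ s ∈ C, ∀ s', 0 < (M ^ n) s s' → 0 < (N ^ n) s s' := by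
    induction n with
    | zero => intro s _ s' h; simpa using h
    | succ n ih =>
      intro s hs s' h
      rw [pow_succ', Matrix.mul_apply] at h ⊢
      obtain ⟨v, -, hv⟩ := exists_lt_of_sum_lt (f := fun _ => (0 : ℝ)) (by simpa using h)
      have hMv : 0 < M s v := pos_of_mul_pos_left hv ((pow_mem hM n).1 _ _)
      have hMnv : 0 < (M ^ n) v s' := pos_of_mul_pos_right hv (hM.1 _ _)
      have hvC : v ∈ C := by
        by_contra h
        exact hMv.ne' (hcl s hs v h)
      exact sum_pos' (fun u _ => mul_nonneg (hN.1 _ _) ((pow_mem hN n).1 _ _))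
        ⟨v, mem_univ v, mul_pos (hMN s hs v hMv) (ih v hvC s' hMnv)⟩
  intro s hs s' hs'
  obtain ⟨n, hn⟩ := hirr s hs s' hs'
  exact ⟨n, key n s hs s' hn⟩

end StochasticMatrix

/-- A segment ending in a relative interior point of a set can be prolonged within the set. -/
lemma exists_pos_lineMap_neg_mem_of_mem_intrinsicInterior {E : Type*} [NormedAddCommGroup E]
    [NormedSpace ℝ E] {X : Set E} {x y : E} (hx : x ∈ intrinsicInterior ℝ X) (hy : y ∈ X) :
    ∃ ε > (0 : ℝ), AffineMap.lineMap x y (-ε) ∈ X := by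
  obtain ⟨z, hz, rfl⟩ := mem_intrinsicInterior.1 hx
  let f : ℝ → affineSpan ℝ X := fun t =>
    ⟨AffineMap.lineMap (z : E) y (-t), AffineMap.lineMap_mem _ z.2 (subset_affineSpan ℝ X hy)⟩
  have hf : Continuous f := Continuous.subtype_mk (by fun_prop) _
  have hf0 : f 0 = z := by simp [f]
  have hev : ∀ᶠ t in 𝓝 (0 : ℝ), f t ∈ ((↑) ⁻¹' X : Set (affineSpan ℝ X)) :=
    hf.continuousAt.eventually_mem (by rw [hf0]; exact mem_interior_iff_mem_nhds.1 hz)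
  obtain ⟨ε, hε, hεpos⟩ :=
    ((hev.filter_mono nhdsWithin_le_nhds).and (self_mem_nhdsWithin (s := Set.Ioi 0))).exists
  exact ⟨ε, hεpos, hε⟩

section MDP

/-- Disintegration of a nonnegative function on state-action pairs into its state marginal and a
policy that agrees with `π₀` where the marginal vanishes. -/
lemma exists_policy_of_nonneg {S A : Type*} [Fintype A] {π₀ : S → A → ℝ} (hπ₀ : IsPolicy π₀) {q : S × A → ℝ}
    (hq : ∀ p, 0 ≤ q p) : ∃ π : S → A → ℝ, IsPolicy π ∧
      ∀ s a, q (s, a) = (∑ a', q (s, a')) * π s a := by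
  classical
  refine ⟨fun s a => if ∑ a', q (s, a') = 0 then π₀ s a else q (s, a) / ∑ a', q (s, a'),
    ⟨fun s a => ?_, fun s => ?_⟩, fun s a => ?_⟩
  · dsimp only
    split_ifs
    · exact hπ₀.1 s a
    · exact div_nonneg (hq _) (sum_nonneg fun _ _ => hq _)
  · by_cases h : ∑ a', q (s, a') = 0
    · simp only [h, if_true, hπ₀.2]
    · simp only [h, if_false, ← sum_div, div_self h]
  · dsimp only
    split_ifs with h
    · rw [h, zero_mul]
      exact (sum_eq_zero_iff_of_nonneg fun _ _ => hq _).1 h a (mem_univ a)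
    · rw [mul_div_cancel₀ _ h]

open Matrix

variable {S A : Type*} [Fintype S] [Fintype A]
  {P : S → A → S → ℝ} {π : S → A → ℝ}

lemma markovMatrix_mem_rowStochastic [DecidableEq S] (hP : IsKernel P) (hπ : IsPolicy π) :
    markovMatrix P π ∈ rowStochastic ℝ S := by
  rw [mem_rowStochastic_iff_sum]
  refine ⟨fun s s' => sum_nonneg fun a _ => mul_nonneg (hπ.1 s a) (hP.1 s a s'), fun s => ?_⟩
  simp only [markovMatrix]
  rw [sum_comm]
  simp only [← mul_sum, hP.2, mul_one, hπ.2]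

/-- The flow constraints at `μ(s) π(s, a)` express stationarity of `μ` under `π`. -/
lemma vecMul_markovMatrix_eq_sum {μ : S → ℝ} {q : S × A → ℝ}
    (hq : ∀ s a, q (s, a) = μ s * π s a) (s' : S) :
    (μ ᵥ* markovMatrix P π) s' = ∑ p : S × A, P p.1 p.2 s' * q p := by
  simp only [Matrix.vecMul, dotProduct, markovMatrix, Fintype.sum_prod_type, hq, mul_sum]
  exact sum_congr rfl fun s _ => sum_congr rfl fun a _ => by ring

lemma mem_flowPolytope_of_stationary (hπ : IsPolicy π) {μ : S → ℝ} (hμ : μ ∈ stdSimplex ℝ S)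
    (hst : μ ᵥ* markovMatrix P π = μ) : (fun p : S × A => μ p.1 * π p.1 p.2) ∈ flowPolytope P := by
  refine ⟨fun p => mul_nonneg (hμ.1 _) (hπ.1 _ _), ?_, fun s => ?_⟩
  · simp only [Fintype.sum_prod_type, ← mul_sum, hπ.2, mul_one, hμ.2]
  · rw [← vecMul_markovMatrix_eq_sum (fun _ _ => rfl), hst]
    simp only [← mul_sum, hπ.2, mul_one]

lemma marginal_mem_stdSimplex {q : S × A → ℝ} (hq : q ∈ flowPolytope P) :
    (fun s => ∑ a, q (s, a)) ∈ stdSimplex ℝ S :=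
  ⟨fun _ => sum_nonneg fun _ _ => hq.1 _, by simpa [Fintype.sum_prod_type] using hq.2.1⟩

/-- A relative interior point of the flow polytope has the largest support. -/
lemma pos_of_mem_intrinsicInterior_flowPolytope {q q₀ : S × A → ℝ}
    (hq : q ∈ intrinsicInterior ℝ (flowPolytope P)) (hq₀ : q₀ ∈ flowPolytope P) {p : S × A}
    (hp : 0 < q₀ p) : 0 < q p := by
  obtain ⟨ε, hε, hmem⟩ := exists_pos_lineMap_neg_mem_of_mem_intrinsicInterior hq hq₀
  have h := hmem.1 p
  simp only [AffineMap.lineMap_apply, vsub_eq_sub, vadd_eq_add, Pi.add_apply, Pi.smul_apply,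
    Pi.sub_apply, smul_eq_mul] at h
  have hqp : 0 ≤ q p := (intrinsicInterior_subset hq).1 p
  by_contra hn
  have : q p = 0 := le_antisymm (not_lt.1 hn) hqp
  rw [this] at h
  nlinarith [mul_pos hε hp]

end MDP

/-- **Every relative-interior point of the flow polytope is the occupation measure of a
unichain stationary policy.** -/
theorem relint_point_is_unichain_occupation
    {S A : Type*} [Fintype S] [DecidableEq S] [Fintype A] [Nonempty S] [Nonempty A]
    (P : S → A → S → ℝ) (hP : IsKernel P) (hwc : WeaklyCommunicating P)
    (s₁ : S) (qstar : S × A → ℝ)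
    (hq : qstar ∈ intrinsicInterior ℝ (flowPolytope P)) :
    ∃ π : S → A → ℝ, IsPolicy π ∧
      (∃ C : Set S, C.Nonempty ∧ IsClosedClass (markovMatrix P π) C ∧
        IsIrreducibleOn (markovMatrix P π) C ∧
        ∀ s ∉ C, IsTransient (markovMatrix P π) s) ∧
      IsOccupation P π s₁ qstar := by
  obtain ⟨π₀, C, hπ₀, hC, hcl₀, hirr₀, htr⟩ := hwc
  have hqmem : qstar ∈ flowPolytope P := intrinsicInterior_subset hq
  obtain ⟨π, hπ, hfac⟩ := exists_policy_of_nonneg hπ₀ hqmem.1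
  have hM₀ := markovMatrix_mem_rowStochastic hP hπ₀
  have hM := markovMatrix_mem_rowStochastic hP hπ
  set μ : S → ℝ := fun s => ∑ a, qstar (s, a)
  have hμ : μ ∈ stdSimplex ℝ S := marginal_mem_stdSimplex hqmem
  have hμM : Matrix.vecMul μ (markovMatrix P π) = μ := by
    ext s
    rw [vecMul_markovMatrix_eq_sum hfac, ← hqmem.2.2 s]
  obtain ⟨μ₀, hμ₀, hμ₀M⟩ := exists_stationary hM₀
  have hμ₀_pos (s : S) (hs : s ∈ C) : 0 < μ₀ s :=
    stationary_pos_on hM₀ hirr₀ (fun s hs => htr s hs π₀ hπ₀) hμ₀ hμ₀M hs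
  have hq_pos (s : S) (hs : s ∈ C) (a : A) (ha : 0 < π₀ s a) : 0 < qstar (s, a) :=
    pos_of_mem_intrinsicInterior_flowPolytope hq (mem_flowPolytope_of_stationary hπ₀ hμ₀ hμ₀M)
      (mul_pos (hμ₀_pos s hs) ha)
  have htrπ (s : S) (hs : s ∉ C) : IsTransient (markovMatrix P π) s := htr s hs π hπ
  have hirr : IsIrreducibleOn (markovMatrix P π) C := by
    refine hirr₀.of_pos_imp hM₀ hM hcl₀ fun s hs s' h => ?_
    obtain ⟨a, -, ha⟩ := exists_lt_of_sum_lt (f := fun _ => (0 : ℝ)) (by simpa [markovMatrix] using h)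
    have hπ₀a : 0 < π₀ s a := pos_of_mul_pos_left ha (hP.1 _ _ _)
    have hPa : 0 < P s a s' := pos_of_mul_pos_right ha (hπ₀.1 _ _)
    have hπa : 0 < π s a :=
      pos_of_mul_pos_right (by simpa only [hfac s a] using hq_pos s hs a hπ₀a) (hμ.1 s)
    exact sum_pos' (fun b _ => mul_nonneg (hπ.1 _ _) (hP.1 _ _ _))
      ⟨a, mem_univ a, mul_pos hπa hPa⟩
  refine ⟨π, hπ, ⟨C, hC, fun s hs s' hs' => ?_, hirr, htrπ⟩, fun s a => ?_⟩
  · by_contra hne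
    have hpos : 0 < (markovMatrix P π ^ 1) s s' := by
      rw [pow_one]
      exact lt_of_le_of_ne (hM.1 _ _) (Ne.symm hne)
    exact (pos_of_stationary_of_pow_pos hM hμ.1 hμM
      (stationary_pos_on hM hirr htrπ hμ hμM hs) hpos).ne'
      ((htrπ s' hs').stationary_eq_zero hM hμ hμM)
  · have hlim := tendsto_pi_nhds.1 (tendsto_cesaroRow_of_unique hM s₁ fun ν hν hνM =>
      stationary_unique hM hC hirr htrπ hμ hμM hν hνM) s
    rw [hfac s a]
    refine (hlim.mul_const (π s a)).congr fun T => ?_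
    simp only [cesaroRow, Pi.smul_apply, Finset.sum_apply, Matrix.row_apply, smul_eq_mul,
      one_div, ← sum_mul, mul_assoc]
end
end
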